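/- arXiv:2507.17124 — 2 statements merged into one kernel-verified Lean document; each statement's English description precedes it below -/
import Mathlib

section
/- Let κ be an infinite cardinal. The following are equivalent: (1) 2^κ = κ⁺; (2) there is a κ⁺-barely independent family over κ⁺; (3) there is a strongly independent family over κ⁺ of cardinality κ⁺; (4) there is a strongly independent family over κ⁺ of cardinality κ. -/
open Cardinal Set

/-- The boolean combination `⋂_{A ∈ 𝓐} A^{h(A)}`, where `A^0 = A` and `A^1` is the
complement of `A`. -/
def BoolComb {α : Type} (𝓐 : Set (Set α)) (h : Set α → Fin 2) : Set α :=
  ⋂ A ∈ 𝓐, if h A = 0 then A else Aᶜ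

/-- A family `I` of subsets of a set `α` (of cardinality `λ = #α`) is `κ`-barely independent
over `α` if all its members have cardinality `#α`, `|I| ≥ κ`, every boolean combination of
fewer than `κ` members has cardinality `#α`, and every boolean combination of exactly `κ`
members has cardinality `< #α`. -/
def KBarelyIndependent {α : Type} (κ : Cardinal) (I : Set (Set α)) : Prop :=
  κ ≤ #I ∧ (∀ A ∈ I, #A = #α) ∧
  (∀ 𝓐 ⊆ I, 𝓐.Nonempty → #𝓐 < κ → ∀ h : Set α → Fin 2, #(BoolComb 𝓐 h) = #α) ∧
  (∀ 𝓐 ⊆ I, #𝓐 = κ → ∀ h : Set α → Fin 2, #(BoolComb 𝓐 h) < #α)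

/-- A family `I` of subsets of a set `α` (of cardinality `μ = #α`) is strongly independent
over `α` if every boolean combination of a nonempty subfamily of size `< #α` has
cardinality `#α`. -/
def StronglyIndependent {α : Type} (I : Set (Set α)) : Prop :=
  ∀ 𝓐 ⊆ I, 𝓐.Nonempty → #𝓐 < #α → ∀ h : Set α → Fin 2, #(BoolComb 𝓐 h) = #α

/-- A family of at least as large sets as there are indices has an injective choice function. -/
theorem exists_injective_forall_mem {ι α : Type} (S : ι → Set α) (hS : ∀ i, #ι ≤ #(S i)) :
    ∃ f : ι → α, Function.Injective f ∧ ∀ i, f i ∈ S i := by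
  obtain ⟨_, _, hord⟩ := Cardinal.exists_ord_eq_type_lt ι
  have step : ∀ (i : ι) (g : ∀ j, j < i → α), ∃ x ∈ S i, ∀ j (hj : j < i), g j hj ≠ x := by
    intro i g
    have hlt : #(range fun j : Iio i => g j.1 j.2) < #(S i) :=
      mk_range_le.trans_lt ((mk_Iio_lt i hord).trans_le (hS i))
    obtain ⟨x, hx, hxg⟩ := not_subset.1 fun h => (mk_le_mk_of_subset h).not_gt hlt
    exact ⟨x, hx, fun j hj h => hxg ⟨⟨j, hj⟩, h⟩⟩
  choose F hFS hFne using step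
  let f : ι → α := (wellFounded_lt (α := ι)).fix F
  have hf : ∀ i, f i = F i fun j _ => f j := fun i => WellFounded.fix_eq _ F i
  have hne : ∀ i j, j < i → f j ≠ f i := fun i j hj => by
    rw [hf i]; exact hFne i (fun j _ => f j) j hj
  refine ⟨f, fun i j hij => ?_, fun i => by rw [hf i]; exact hFS _ _⟩
  rcases lt_trichotomy i j with h | h | h
  · exact (hne _ _ h hij).elim
  · exact h
  · exact (hne _ _ h hij.symm).elim

/-- At most `κ` many sets of cardinality at least `κ` can be split by a single set. -/
theorem exists_forall_inter_diff_nonempty {κ : Cardinal} (hκ : ℵ₀ ≤ κ) {ι α : Type}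
    (hι : #ι ≤ κ) (S : ι → Set α) (hS : ∀ i, κ ≤ #(S i)) :
    ∃ Y : Set α, ∀ i, (S i ∩ Y).Nonempty ∧ (S i \ Y).Nonempty := by
  have hcard : #(ι × Bool) ≤ κ := by
    rw [mk_prod, lift_id, lift_id]
    exact mul_le_of_le hκ hι (by simpa using (natCast_lt_aleph0 (n := 2)).le.trans hκ)
  obtain ⟨f, hf, hfS⟩ :=
    exists_injective_forall_mem (fun p : ι × Bool => S p.1) fun p => hcard.trans (hS p.1)
  refine ⟨range fun i => f (i, true), fun i =>
    ⟨⟨_, hfS (i, true), i, rfl⟩, ⟨_, hfS (i, false), ?_⟩⟩⟩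
  rintro ⟨j, hj⟩
  simpa using hf hj

theorem mem_boolComb {α : Type} {𝓐 : Set (Set α)} {h : Set α → Fin 2} {x : α} :
    x ∈ BoolComb 𝓐 h ↔ ∀ A ∈ 𝓐, (x ∈ A ↔ h A = 0) := by
  simp only [BoolComb, mem_iInter]
  refine forall₂_congr fun A _ => ?_
  split_ifs with hA <;> simp [hA]

/-- If `2 ^ κ = κ⁺`, then `κ⁺` surjects onto the subsets of `κ⁺` of cardinality at most `κ`
with all fibres of cardinality `κ⁺`. -/
theorem exists_enum_bounded_sets {κ : Cardinal} (hκ : ℵ₀ ≤ κ) (h2 : 2 ^ κ = Order.succ κ)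
    {α : Type} (hα : #α = Order.succ κ) :
    ∃ e : α → Set α, ∀ G : Set α, #G ≤ κ → #(e ⁻¹' {G}) = #α := by
  have hαinf : ℵ₀ ≤ #α := hα ▸ hκ.trans (Order.le_succ κ)
  have hcard : #{t : Set α // #t ≤ κ} ≤ #α := by
    refine (mk_bounded_set_le α κ).trans ?_
    rw [max_eq_left hαinf, hα, ← h2, ← power_mul, mul_eq_self hκ]
  have : Nonempty ({t : Set α // #t ≤ κ} × α) :=
    ⟨⟨⟨∅, by simp⟩, (mk_ne_zero_iff.1 (aleph0_pos.trans_le hαinf).ne').some⟩⟩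
  have hle : #({t : Set α // #t ≤ κ} × α) ≤ #α := by
    rw [mk_prod, lift_id, lift_id]
    exact mul_le_of_le hαinf hcard le_rfl
  obtain ⟨g⟩ := Cardinal.le_def _ _ |>.1 hle
  refine ⟨fun a => (Function.invFun g a).1.1, fun G hG => (mk_set_le _).antisymm ?_⟩
  refine mk_le_of_injective
    (f := fun a : α => (⟨g (⟨G, hG⟩, a), ?_⟩ : (_ : Set α))) fun a b hab => ?_
  · simp [Function.leftInverse_invFun g.injective _]
  · simpa using hab

/-- In a linear order all of whose initial segments have size at most `κ`, at most `κ` many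
points fail to lie strictly above every element of a given set of size at most `κ`. -/
theorem mk_biUnion_Iic_le {κ : Cardinal} (hκ : ℵ₀ ≤ κ) {α : Type} [LinearOrder α]
    (hIic : ∀ a : α, #(Iic a) ≤ κ) {D : Set α} (hD : #D ≤ κ) : #(⋃ d ∈ D, Iic d) ≤ κ :=
  (mk_biUnion_le _ _).trans (mul_le_of_le hκ hD (ciSup_le' fun d => hIic d))

theorem exists_linearOrder_mk_Iic_le {κ : Cardinal} (hκ : ℵ₀ ≤ κ) {α : Type}
    (hα : #α = Order.succ κ) : ∃ _ : LinearOrder α, ∀ a : α, #(Iic a) ≤ κ := by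
  obtain ⟨_, _, hord⟩ := Cardinal.exists_ord_eq_type_lt α
  refine ⟨inferInstance, fun a => Order.lt_succ_iff.1 ?_⟩
  rw [← hα]
  exact mk_Iic_lt a hord (hα ▸ hκ.trans (Order.le_succ κ))

theorem exists_kBarelyIndependent {κ : Cardinal} (hκ : ℵ₀ ≤ κ) (h2 : 2 ^ κ = Order.succ κ)
    {α : Type} (hα : #α = Order.succ κ) :
    ∃ I : Set (Set α), KBarelyIndependent (Order.succ κ) I := by
  obtain ⟨_, hIic⟩ := exists_linearOrder_mk_Iic_le hκ hα
  obtain ⟨e, he⟩ := exists_enum_bounded_sets hκ h2 hα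
  have hκα : κ < #α := hα ▸ Order.lt_succ κ
  have hsplit : ∀ b : α, ∃ Y : Set α, ∀ c < b, #(e c) = κ →
      (e c ∩ Y).Nonempty ∧ (e c \ Y).Nonempty := by
    intro b
    obtain ⟨Y, hY⟩ := exists_forall_inter_diff_nonempty hκ
      (ι := {c // c < b ∧ #(e c) = κ})
      ((mk_subtype_mono fun c hc => hc.1.le).trans (hIic b))
      (fun c => e c.1) (fun c => c.2.2.ge)
    exact ⟨Y, fun c hc hcκ => hY ⟨c, hc, hcκ⟩⟩
  choose Y hY using hsplit
  let A : α → Set α := fun b => {a | a < b ∧ a ∈ Y b ∨ b < a ∧ b ∈ e a}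
  have hA : ∀ D G : Set α, #D ≤ κ → G ⊆ D → #{a | ∀ b ∈ D, (a ∈ A b ↔ b ∈ G)} = #α := by
    intro D G hD hG
    refine (mk_set_le _).antisymm ?_
    have hbig := he G ((mk_le_mk_of_subset hG).trans hD)
    have hsub : e ⁻¹' {G} ⊆ {a | ∀ b ∈ D, (a ∈ A b ↔ b ∈ G)} ∪ ⋃ d ∈ D, Iic d := by
      intro a ha
      by_cases hd : a ∈ ⋃ d ∈ D, Iic d
      · exact Or.inr hd
      · refine Or.inl fun b hb => ?_
        have hlt : b < a := by
          by_contra hle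
          exact hd (mem_biUnion hb (not_lt.1 hle))
        have ha : e a = G := ha
        simp [A, hlt, hlt.not_gt, ha]
    by_contra hlt
    refine ((mk_le_mk_of_subset hsub).trans (mk_union_le _ _)).not_gt ?_
    rw [hbig]
    exact add_lt_of_lt (hκ.trans hκα.le) (not_le.1 hlt)
      ((mk_biUnion_Iic_le hκ hIic hD).trans_lt hκα)
  have hAinj : Function.Injective A := by
    intro b c hbc
    by_contra hne
    have h := hA {b, c} {b} (((Set.toFinite _).lt_aleph0).le.trans hκ) (by simp)
    obtain ⟨a, ha⟩ : {a | ∀ d ∈ ({b, c} : Set α), (a ∈ A d ↔ d ∈ ({b} : Set α))}.Nonempty := by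
      rw [← Set.nonempty_coe_sort, ← mk_ne_zero_iff, h]
      exact (bot_le.trans_lt hκα).ne'
    have h1 := ha b (by simp)
    have h3 := ha c (by simp)
    rw [hbc] at h1
    simp_all
  have hcomb : ∀ 𝓐 ⊆ range A, #𝓐 ≤ κ → ∀ h : Set α → Fin 2, #(BoolComb 𝓐 h) = #α := by
    intro 𝓐 h𝓐 hcard h
    have hD : #(A ⁻¹' 𝓐) ≤ κ := (mk_preimage_of_injective _ _ hAinj).trans hcard
    rw [← hA (A ⁻¹' 𝓐) {b | A b ∈ 𝓐 ∧ h (A b) = 0} hD fun b hb => hb.1]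
    congr 2
    ext a
    rw [mem_boolComb]
    constructor
    · intro ha b hb
      simp [ha _ hb, show A b ∈ 𝓐 from hb]
    · intro ha B hB
      obtain ⟨b, rfl⟩ := h𝓐 hB
      simpa [hB] using ha b hB
  refine ⟨range A, ?_, ?_, fun 𝓐 h𝓐 _ hcard => hcomb 𝓐 h𝓐 (Order.lt_succ_iff.1 hcard), ?_⟩
  · rw [mk_range_eq A hAinj, hα]
  · intro B hB
    have := hcomb {B} (by simpa using hB) (by simpa using one_le_aleph0.trans hκ) fun _ => 0
    simpa [BoolComb] using this
  · intro 𝓐 h𝓐 hcard h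
    by_contra hge
    obtain ⟨C, hC, hCκ⟩ := le_mk_iff_exists_subset.1 (hκα.le.trans (not_lt.1 hge))
    obtain ⟨c, hc⟩ : (e ⁻¹' {C}).Nonempty := by
      rw [← Set.nonempty_coe_sort, ← mk_ne_zero_iff, he C hCκ.le]
      exact (bot_le.trans_lt hκα).ne'
    have hc : e c = C := hc
    have hsub : 𝓐 ⊆ A '' (⋃ d ∈ insert c C, Iic d) := by
      intro B hB
      obtain ⟨b, rfl⟩ := h𝓐 hB
      refine ⟨b, ?_, rfl⟩
      by_contra hb
      have hlt : ∀ d ∈ insert c C, d < b := fun d hd => by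
        by_contra hle
        exact hb (mem_biUnion hd (not_lt.1 hle))
      obtain ⟨⟨x, hxC, hxY⟩, ⟨y, hyC, hyY⟩⟩ :=
        hY b c (hlt c (mem_insert _ _)) (hc ▸ hCκ)
      rw [hc] at hxC hyC
      have hx := mem_boolComb.1 (hC hxC) _ hB
      have hy := mem_boolComb.1 (hC hyC) _ hB
      have hxb := hlt x (mem_insert_of_mem _ hxC)
      have hyb := hlt y (mem_insert_of_mem _ hyC)
      have hxA : x ∈ A b := Or.inl ⟨hxb, hxY⟩
      have hyA : y ∉ A b := by
        rintro (h | h)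
        · exact hyY h.2
        · exact hyb.not_gt h.1
      exact hyA (hy.2 (hx.1 hxA))
    have hins : #(insert c C : Set α) ≤ κ :=
      (mk_insert_le).trans (add_le_of_le hκ hCκ.le (one_le_aleph0.trans hκ))
    have := (mk_le_mk_of_subset hsub).trans
      (mk_image_le.trans (mk_biUnion_Iic_le hκ hIic hins))
    rw [hcard] at this
    exact this.not_gt (Order.lt_succ κ)

theorem StronglyIndependent.mono {α : Type} {I J : Set (Set α)} (hI : StronglyIndependent I)
    (hJ : J ⊆ I) : StronglyIndependent J :=
  fun 𝓐 h𝓐 => hI 𝓐 (h𝓐.trans hJ)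

/-- A nonempty strongly independent family smaller than the base set has at most as many boolean
combinations as the base set has points. -/
theorem StronglyIndependent.two_power_le {α : Type} {I : Set (Set α)}
    (hI : StronglyIndependent I) (hne : I.Nonempty) (hlt : #I < #α) : 2 ^ #I ≤ #α := by
  classical
  have hex : ∀ s : Set I, ∃ x : α, ∀ A : I, x ∈ A.1 ↔ A ∈ s := by
    intro s
    let h : Set α → Fin 2 := fun A => if A ∈ Subtype.val '' s then 0 else 1
    have hcard := hI I subset_rfl hne hlt h
    obtain ⟨x, hx⟩ : (BoolComb I h).Nonempty := by
      rw [← Set.nonempty_coe_sort, ← mk_ne_zero_iff, hcard]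
      exact (bot_le.trans_lt hlt).ne'
    refine ⟨x, fun A => (mem_boolComb.1 hx A A.2).trans ?_⟩
    simp [h]
  choose f hf using hex
  rw [← mk_set]
  refine mk_le_of_injective (f := f) fun s t hst => ?_
  ext A
  rw [← hf s A, hst, hf t A]

/-- For an infinite cardinal `κ`, the following are equivalent: (1) `2^κ = κ⁺`;
(2) there is a `κ⁺`-barely independent family over `κ⁺`; (3) there is a strongly
independent family over `κ⁺` of cardinality `κ⁺`; (4) there is a strongly independent
family over `κ⁺` of cardinality `κ`. -/
theorem stmt7 (κ : Cardinal) (hκ : ℵ₀ ≤ κ) :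
    [2 ^ κ = Order.succ κ,
     ∃ I : Set (Set (Order.succ κ).out), KBarelyIndependent (Order.succ κ) I,
     ∃ I : Set (Set (Order.succ κ).out), StronglyIndependent I ∧ #I = Order.succ κ,
     ∃ I : Set (Set (Order.succ κ).out), StronglyIndependent I ∧ #I = κ].TFAE := by
  have hμ : #(Order.succ κ).out = Order.succ κ := mk_out _
  tfae_have 1 → 2 := fun h => exists_kBarelyIndependent hκ h hμ
  tfae_have 2 → 3 := by
    rintro ⟨I, hcard, -, hI, -⟩
    obtain ⟨J, hJ, hJcard⟩ := le_mk_iff_exists_subset.1 hcard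
    exact ⟨J, fun 𝓐 h𝓐 hne hlt => hI 𝓐 (h𝓐.trans hJ) hne (hlt.trans_eq hμ), hJcard⟩
  tfae_have 3 → 4 := by
    rintro ⟨I, hI, hcard⟩
    obtain ⟨J, hJ, hJcard⟩ := le_mk_iff_exists_subset.1 ((Order.le_succ κ).trans_eq hcard.symm)
    exact ⟨J, hI.mono hJ, hJcard⟩
  tfae_have 4 → 1 := by
    rintro ⟨I, hI, hcard⟩
    refine le_antisymm ?_ (Order.succ_le_of_lt (cantor κ))
    have hne : I.Nonempty := by
      rw [← Set.nonempty_coe_sort, ← mk_ne_zero_iff, hcard]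
      exact (aleph0_pos.trans_le hκ).ne'
    have hlt : #I < #(Order.succ κ).out := by
      rw [hμ, hcard]
      exact Order.lt_succ κ
    simpa only [hcard, hμ] using hI.two_power_le hne hlt
  tfae_finish
end

section
/- Let λ be an infinite cardinal with λ ≤ cof(𝔠). If 𝔯(ω,λ) = 𝔠, then there is a barely independent family over cof(𝔠) of cardinality λ. -/
open Cardinal Set

/-- `S` splits `R` if both `R ∩ S` and `R \ S` are infinite. (`R` reaps `S` otherwise.) -/
def Splits {α : Type} (S R : Set α) : Prop := (R ∩ S).Infinite ∧ (R \ S).Infinite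

/-- The generalized reaping number `𝔯(κ, λ)`: the least cardinality of a family `R` of
`κ`-sized subsets of `λ` such that every `S ⊆ λ` is reaped by some member of `R`. -/
noncomputable def reapingNumber (κ lam : Cardinal) : Cardinal :=
  sInf {c | ∃ R : Set (Set lam.out), #R = c ∧ (∀ r ∈ R, #r = κ) ∧
    ∀ S : Set lam.out, ∃ r ∈ R, ¬ Splits S r}

/-- A set of cardinality at most `c` is a union of `cof c` many sets of cardinality less
than `c`, in such a way that every point belongs to almost all of them. -/
theorem exists_mk_lt_and_mk_notMem_lt {c : Cardinal.{0}} (hc : ℵ₀ ≤ c) {K D : Type}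
    (hK : #K = c.ord.cof) (hD : #D ≤ c) :
    ∃ F : K → Set D, (∀ k, #(F k) < c) ∧ ∀ d, #{k | d ∉ F k} < #K := by
  obtain ⟨s, hs, hs'⟩ := Ordinal.exists_ord_cof_eq c.ord.ToType
  have hord : (#s).ord = Ordinal.type (α := s) (· < ·) := by
    rw [hs', ← Ordinal.card_type (α := s) (· < ·), hs', card_ord]
  have hsK : #K = #s := by
    rw [hK, ← Ordinal.card_type (α := s) (· < ·), hs', card_ord, Ordinal.cof_toType]
  obtain ⟨e⟩ := Cardinal.eq.1 hsK
  obtain ⟨f⟩ : Nonempty (D ↪ c.ord.ToType) := by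
    rwa [← Cardinal.le_def, Cardinal.mk_ord_toType]
  refine ⟨fun k => {d | f d ≤ e k}, fun k => ?_, fun d => ?_⟩
  · have h : #(Iic (e k : c.ord.ToType)) < c := by
      have := Cardinal.mk_Iic_lt (e k : c.ord.ToType) (by simp) (by simpa using hc)
      simpa using this
    exact (mk_preimage_of_injective f (Iic (e k : c.ord.ToType)) f.injective).trans_lt h
  · obtain ⟨y, hy, hdy⟩ := hs (f d)
    have h : #(Iio (⟨y, hy⟩ : s)) < #s := Cardinal.mk_Iio_lt _ hord
    rw [hsK]
    refine lt_of_le_of_lt (mk_le_mk_of_subset ?_ |>.trans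
      (mk_preimage_of_injective e (Iio (⟨y, hy⟩ : s)) e.injective)) h
    intro k hk
    exact (not_le.1 (show ¬ f d ≤ e k from hk)).trans_le hdy

theorem exists_splits_of_mk_lt_reapingNumber {κ lam : Cardinal} {R : Set (Set lam.out)}
    (hR : ∀ r ∈ R, #r = κ) (h : #R < reapingNumber κ lam) : ∃ S, ∀ r ∈ R, Splits S r := by
  by_contra! H
  exact notMem_of_lt_csInf' h ⟨R, rfl, hR, H⟩

theorem Splits.diff_union {α : Type} {S R F G : Set α} (h : Splits S R) (hF : F.Finite)
    (hG : G.Finite) : Splits (S \ F ∪ G) R := by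
  refine ⟨(h.1.sdiff hF).mono ?_, (h.2.sdiff hG).mono ?_⟩ <;> intro x <;>
    simp only [mem_sdiff, mem_inter_iff, mem_union] <;> tauto

/-- A map from an infinite set onto a set of at most the same cardinality may be chosen with
all fibres of full cardinality. -/
theorem exists_mk_fiber_eq {K P : Type} [Infinite K] [Nonempty P] (hP : #P ≤ #K) :
    ∃ g : K → P, ∀ p, #{k | g k = p} = #K := by
  obtain ⟨e⟩ : Nonempty (K ≃ K × P) := by
    rw [← Cardinal.eq, mk_prod, Cardinal.lift_id, Cardinal.lift_id,
      mul_eq_left (aleph0_le_mk K) hP (mk_ne_zero P)]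
  refine ⟨fun k => (e k).2, fun p => le_antisymm (mk_set_le _) ?_⟩
  refine mk_le_of_injective (f := fun k => ⟨e.symm (k, p), by simp⟩) fun a b hab => ?_
  simpa using hab

/-- A sequence of sets realizing each finite pattern often, and splitting each countably
infinite set most of the time, dually gives a barely independent family. -/
theorem kBarelyIndependent_range_of_splits {K L : Type} [Infinite L] [Infinite K]
    (S : K → Set L)
    (hfin : ∀ F G : Set L, F.Finite → G.Finite → Disjoint F G →
      #{k | F ⊆ S k ∧ Disjoint G (S k)} = #K)
    (hsplit : ∀ R : Set L, #R = ℵ₀ → #{k | ¬ Splits (S k) R} < #K) :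
    KBarelyIndependent ℵ₀ (range fun i => {k | i ∈ S k}) ∧
      #(range fun i => {k | i ∈ S k}) = #L := by
  have hinj : Function.Injective fun i => {k | i ∈ S k} := by
    intro i j hij
    by_contra hne
    have h := hfin {i} {j} (finite_singleton i) (finite_singleton j) (by simpa using hne)
    have hemp : {k | {i} ⊆ S k ∧ Disjoint {j} (S k)} = ∅ := by
      ext k
      have := Set.ext_iff.1 hij k
      simp only [mem_ofPred_eq] at this
      simp [this]
    rw [hemp, mk_eq_zero] at h
    exact mk_ne_zero K h.symm
  have hcard := mk_range_eq _ hinj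
  refine ⟨⟨hcard ▸ aleph0_le_mk L, ?_, ?_, ?_⟩, hcard⟩
  · rintro _ ⟨i, rfl⟩
    simpa using hfin {i} ∅ (finite_singleton i) finite_empty (by simp)
  · intro 𝓐 h𝓐 _ hlt h
    have hpre := (lt_aleph0_iff_set_finite.1 hlt).preimage hinj.injOn
    refine le_antisymm (mk_set_le _) ?_
    rw [← hfin {i | {k | i ∈ S k} ∈ 𝓐 ∧ h {k | i ∈ S k} = 0}
      {i | {k | i ∈ S k} ∈ 𝓐 ∧ h {k | i ∈ S k} ≠ 0} (hpre.subset fun i hi => hi.1)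
      (hpre.subset fun i hi => hi.1)
      (Set.disjoint_left.2 fun i hi hi' => hi'.2 hi.2)]
    refine mk_le_mk_of_subset ?_
    rintro k ⟨hF, hG⟩
    simp only [BoolComb, mem_iInter]
    intro A hA
    obtain ⟨i, rfl⟩ := h𝓐 hA
    split_ifs with h0
    · exact hF ⟨hA, h0⟩
    · exact Set.disjoint_left.1 hG ⟨hA, h0⟩
  · intro 𝓐 h𝓐 heq h
    set R : Set L := (fun i => {k | i ∈ S k}) ⁻¹' 𝓐 with hR
    have hRcard : #R = ℵ₀ := by
      rw [← heq, hR, mk_preimage_of_injective_of_subset_range _ _ hinj h𝓐]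
    have hRinf : R.Infinite := by
      rw [← infinite_coe_iff, infinite_iff, hRcard]
    have hsub : ∀ R' ⊆ R, R'.Infinite → #R' = ℵ₀ := fun R' hR' hinf =>
      ((mk_le_mk_of_subset hR').trans hRcard.le).antisymm
        (infinite_iff.1 hinf.to_subtype)
    have hmem : ∀ k ∈ BoolComb 𝓐 h, ∀ i ∈ R, h {k | i ∈ S k} = 0 ↔ i ∈ S k := by
      intro k hk i hi
      have hki := mem_iInter₂.1 hk _ hi
      split_ifs at hki with h0
      · exact iff_of_true h0 hki
      · exact iff_of_false h0 hki
    by_cases h0 : {i ∈ R | h {k | i ∈ S k} = 0}.Infinite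
    · refine (mk_le_mk_of_subset fun k hk hsp => hsp.2 ?_).trans_lt
        (hsplit _ (hsub _ (fun i hi => hi.1) h0))
      convert finite_empty
      refine eq_empty_of_forall_notMem fun i hi => hi.2 ((hmem k hk i hi.1.1).1 hi.1.2)
    · have h1 : (R \ {i ∈ R | h {k | i ∈ S k} = 0}).Infinite := hRinf.sdiff (not_infinite.1 h0)
      refine (mk_le_mk_of_subset fun k hk hsp => hsp.1 ?_).trans_lt
        (hsplit _ (hsub _ sdiff_subset h1))
      convert finite_empty
      refine eq_empty_of_forall_notMem fun i hi =>
        hi.1.2 ⟨hi.1.1, (hmem k hk i hi.1.1).2 hi.2⟩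

/-- Let `lam` be an infinite cardinal with `lam ≤ cof(𝔠)`. If `𝔯(ω, lam) = 𝔠`, then there
is a barely independent (i.e. `ℵ₀`-barely independent) family over `cof(𝔠)` of
cardinality `lam`. -/
theorem stmt10 (lam : Cardinal) (hlam : ℵ₀ ≤ lam)
    (hle : lam ≤ Cardinal.continuum.ord.cof)
    (hr : reapingNumber ℵ₀ lam = Cardinal.continuum) :
    ∃ I : Set (Set (Cardinal.continuum.ord.cof).out),
      KBarelyIndependent ℵ₀ I ∧ #I = lam := by
  set K := (Cardinal.continuum.ord.cof).out
  have hK : #K = Cardinal.continuum.ord.cof := mk_out _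
  have hL : #lam.out = lam := mk_out _
  have : Infinite K := infinite_iff.2 (hK ▸ hlam.trans hle)
  have : Infinite lam.out := infinite_iff.2 (hL.symm ▸ hlam)
  have hD : #{R : Set lam.out // #R = ℵ₀} ≤ 𝔠 := by
    refine (mk_subtype_mono fun R hR => hR.le).trans
      ((mk_bounded_set_le_of_infinite lam.out ℵ₀).trans ?_)
    rw [hL, ← continuum_power_aleph0]
    exact power_le_power_right (hle.trans (Ordinal.cof_ord_le _))
  obtain ⟨F, hF, hF'⟩ := exists_mk_lt_and_mk_notMem_lt aleph0_le_continuum hK hD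
  have hS (k : K) : ∃ S : Set lam.out, ∀ r ∈ Subtype.val '' F k, Splits S r :=
    exists_splits_of_mk_lt_reapingNumber (κ := ℵ₀) (by rintro _ ⟨r, -, rfl⟩; exact r.2)
      (mk_image_le.trans_lt (hr ▸ hF k))
  choose S hS using hS
  obtain ⟨g, hg⟩ := exists_mk_fiber_eq (K := K) (P := Finset lam.out × Finset lam.out) (by
    rw [mk_prod, mk_finset_of_infinite, lift_id, mul_eq_self (aleph0_le_mk _), hL, hK]
    exact hle)
  refine ⟨_, (kBarelyIndependent_range_of_splits
    (fun k => S k \ (g k).2 ∪ (g k).1) ?_ ?_).imp_right fun h => h.trans hL⟩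
  · intro A B hA hB hAB
    refine le_antisymm (mk_set_le _) ?_
    rw [← hg (hA.toFinset, hB.toFinset)]
    refine mk_le_mk_of_subset fun k hk => ?_
    simp only [mem_ofPred_eq] at hk ⊢
    simp only [hk, Finite.coe_toFinset]
    exact ⟨subset_union_right, disjoint_union_right.2 ⟨disjoint_sdiff_right, hAB.symm⟩⟩
  · intro R hR
    refine lt_of_le_of_lt (mk_le_mk_of_subset ?_) (hF' ⟨R, hR⟩)
    refine fun k hk hkR => hk ?_
    exact (hS k R ⟨_, hkR, rfl⟩).diff_union (Finset.finite_toSet _) (Finset.finite_toSet _)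
end
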